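/- arXiv:1506.05848 — 2 statements merged into one kernel-verified Lean document; each statement's English description precedes it below -/
import Mathlib

section
/- Let P, Q, R, S ∈ ℍ with P ∉ ℝ, write p0 = scal(P) and p = vect(P) ≠ 0, and define R̃ = (Q*P − RP*)(P − P*)^{-1} and S̃ = S + (Q*PR* + RP*Q)/|P − P*|² + R(P* − P)Q/|P − P*|² − Q*P*Q/|P − P*|² − RP*R*/|P − P*|², with s̃0 = scal(S̃) and s̃ = vect(S̃). Suppose S̃ ∉ ℝ (i.e., s̃ ≠ 0). Then the set of solutions X ∈ ℍ of X P X* + X Q + R X* = S is exactly the set of points X = Z − (R − Q*)(P − P*)^{-1} where Z ranges over the intersection of the circle C_{p,s̃} with the hyperplane { Z ∈ ℍ : ⟨Z, R̃⟩ = (s̃0|p| − p0|s̃|)/(2|p|) }. -/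
open Quaternion
open scoped InnerProductSpace Classical

/-- The 2-plane `ℂ_u = ℝ + ℝ u` spanned by `1` and `u` in the quaternions. -/
def complexPlane (u : ℍ[ℝ]) : Set ℍ[ℝ] :=
  {z : ℍ[ℝ] | ∃ a b : ℝ, z = (a : ℍ[ℝ]) + (b : ℍ[ℝ]) * u}

/-- The 2-plane `Π_{p,s}` associated to nonzero pure vector quaternions `p, s`:
if `ŝ ≠ −p̂` it is `u_{p,s} ℂ_{p̂}` with `u_{p,s} = (p̂ + ŝ)/|p̂ + ŝ|`; if `ŝ = −p̂`
it is the 2-plane of pure vector quaternions orthogonal to `p̂`. -/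
noncomputable def PiPlane (p s : ℍ[ℝ]) : Set ℍ[ℝ] :=
  if ‖s‖⁻¹ • s = -(‖p‖⁻¹ • p) then
    {v : ℍ[ℝ] | v.re = 0 ∧ ⟪v, ‖p‖⁻¹ • p⟫_ℝ = 0}
  else
    (fun z => (‖‖p‖⁻¹ • p + ‖s‖⁻¹ • s‖⁻¹ • (‖p‖⁻¹ • p + ‖s‖⁻¹ • s)) * z) ''
      complexPlane (‖p‖⁻¹ • p)

/-- A pure quaternion scaled to norm one squares to `-1`. -/
theorem normalized_pure_mul_self {p : ℍ[ℝ]} (hp : p ≠ 0) (hre : p.re = 0) :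
    (‖p‖⁻¹ • p) * (‖p‖⁻¹ • p) = -1 := by
  have hn : ‖p‖ ≠ 0 := norm_ne_zero_iff.2 hp
  have h1 : p * p = -((‖p‖ * ‖p‖ : ℝ) : ℍ[ℝ]) := by
    rw [← Quaternion.normSq_eq_norm_mul_self, ← Quaternion.self_mul_star,
      Quaternion.star_eq_neg.2 hre, mul_neg, neg_neg]
  rw [smul_mul_smul_comm, h1, smul_neg, ← Quaternion.coe_smul, smul_eq_mul]
  have : ‖p‖⁻¹ * ‖p‖⁻¹ * (‖p‖ * ‖p‖) = 1 := by field_simp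
  rw [this, Quaternion.coe_one]

/-- The centralizer of a pure unit quaternion `a` is the plane spanned by `1` and `a`. -/
theorem mem_complexPlane_iff_commute {a : ℍ[ℝ]} (ha : a * a = -1) (hre : a.re = 0) (w : ℍ[ℝ]) :
    w ∈ complexPlane a ↔ w * a = a * w := by
  constructor
  · rintro ⟨x, y, rfl⟩
    rw [add_mul, mul_add, mul_assoc, ← Quaternion.coe_commutes x a, ← mul_assoc a,
      ← Quaternion.coe_commutes y a, mul_assoc]
  · intro h
    refine ⟨w.re, -(w * a).re, ?_⟩
    have h1 : w * a + star (w * a) = ((2 * (w * a).re : ℝ) : ℍ[ℝ]) :=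
      Quaternion.self_add_star' _
    have h2 : star w = ((2 * w.re : ℝ) : ℍ[ℝ]) - w := by
      rw [← Quaternion.self_add_star' w]; abel
    rw [star_mul, Quaternion.star_eq_neg.2 hre, h2, mul_sub, neg_mul, neg_mul, ← h,
      ← Quaternion.coe_commutes] at h1
    have h3 : (2 : ℝ) • (w * a) = (2 : ℝ) • (((w * a).re : ℍ[ℝ]) + (w.re : ℍ[ℝ]) * a) := by
      rw [smul_add, ← Quaternion.coe_mul_eq_smul 2 (((w * a).re : ℝ) : ℍ[ℝ]),
        ← Quaternion.coe_mul, ← h1, ← Quaternion.coe_mul_eq_smul 2 ((w.re : ℍ[ℝ]) * a),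
        ← mul_assoc, ← Quaternion.coe_mul, two_smul]
      abel
    have h4 := smul_right_injective ℍ[ℝ] (two_ne_zero (α := ℝ)) h3
    have h5 : w = -((w * a) * a) := by rw [mul_assoc, ha]; simp
    conv_lhs => rw [h5, h4, add_mul, mul_assoc, ha]
    push_cast
    noncomm_ring

/-- The plane `PiPlane p s` is the space of intertwiners between `p̂` and `ŝ`. -/
theorem mem_PiPlane_iff {p s : ℍ[ℝ]} (hp : p ≠ 0) (hpre : p.re = 0) (hs : s ≠ 0)
    (hsre : s.re = 0) (Z : ℍ[ℝ]) :
    Z ∈ PiPlane p s ↔ Z * (‖p‖⁻¹ • p) = (‖s‖⁻¹ • s) * Z := by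
  have ha := normalized_pure_mul_self hp hpre
  have hb := normalized_pure_mul_self hs hsre
  have hare : (‖p‖⁻¹ • p).re = 0 := by simp [hpre]
  have ha0 : ‖p‖⁻¹ • p ≠ 0 := smul_ne_zero (inv_ne_zero (norm_ne_zero_iff.2 hp)) hp
  unfold PiPlane
  generalize ‖p‖⁻¹ • p = a at *
  generalize ‖s‖⁻¹ • s = b at *
  split_ifs with h
  · subst h
    have hanti : Z * a - -a * Z = ((2 * Z.re : ℝ) : ℍ[ℝ]) * a - ((2 * ⟪Z, a⟫_ℝ : ℝ) : ℍ[ℝ]) := by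
      rw [Quaternion.inner_def]
      ext <;> simp [hare] <;> ring
    rw [← sub_eq_zero, hanti]
    simp only [Set.mem_ofPred_eq]
    constructor
    · rintro ⟨h1, h2⟩
      simp [h1, h2]
    · intro h0
      have h2 : ⟪Z, a⟫_ℝ = 0 := by
        have := congrArg QuaternionAlgebra.re h0
        simpa [hare] using this
      rw [h2] at h0
      have h1 := (mul_eq_zero.1 (by simpa only [mul_zero, Quaternion.coe_zero, sub_zero] using h0)).resolve_right ha0
      exact ⟨by simpa [-Quaternion.coe_mul] using congrArg QuaternionAlgebra.re h1, h2⟩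
  · have hab : a + b ≠ 0 := fun h0 => h (eq_neg_of_add_eq_zero_right h0)
    have hc : ‖a + b‖⁻¹ ≠ 0 := inv_ne_zero (norm_ne_zero_iff.2 hab)
    have hu0 : ‖a + b‖⁻¹ • (a + b) ≠ 0 := smul_ne_zero hc hab
    have hu : b * (‖a + b‖⁻¹ • (a + b)) = (‖a + b‖⁻¹ • (a + b)) * a := by
      rw [mul_smul_comm, smul_mul_assoc, mul_add, add_mul, ha, hb,
        add_comm (b * a)]
    generalize ‖a + b‖⁻¹ • (a + b) = u at *
    constructor
    · rintro ⟨w, hw, rfl⟩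
      rw [mem_complexPlane_iff_commute ha hare] at hw
      simp only
      rw [mul_assoc, hw, ← mul_assoc, ← mul_assoc, hu]
    · intro hZ
      refine ⟨u⁻¹ * Z, ?_, mul_inv_cancel_left₀ hu0 Z⟩
      rw [mem_complexPlane_iff_commute ha hare]
      apply mul_left_cancel₀ hu0
      rw [← mul_assoc, mul_inv_cancel_left₀ hu0, ← mul_assoc, ← hu, mul_assoc,
        mul_inv_cancel_left₀ hu0, hZ]

/-- The circle `C_{p,s}` is the solution set of `Z p Z* = s`. -/
theorem mem_circle_iff {p s : ℍ[ℝ]} (hp : p ≠ 0) (hpre : p.re = 0) (hs : s ≠ 0)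
    (hsre : s.re = 0) (Z : ℍ[ℝ]) :
    (Z ∈ PiPlane p s ∧ ‖Z‖ = Real.sqrt (‖s‖ / ‖p‖)) ↔ Z * p * star Z = s := by
  rw [mem_PiPlane_iff hp hpre hs hsre]
  have hpn : 0 < ‖p‖ := norm_pos_iff.2 hp
  have hsn : 0 < ‖s‖ := norm_pos_iff.2 hs
  have hnorm : ‖Z‖ = Real.sqrt (‖s‖ / ‖p‖) ↔ ‖Z‖ * ‖Z‖ * ‖p‖ = ‖s‖ := by
    rw [eq_comm, Real.sqrt_eq_iff_mul_self_eq (by positivity) (norm_nonneg _), div_eq_iff hpn.ne',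
      eq_comm]
  have hequiv (h : ‖Z‖ * ‖Z‖ * ‖p‖ = ‖s‖) :
      Z * (‖p‖⁻¹ • p) = (‖s‖⁻¹ • s) * Z ↔ Z * p * star Z = s := by
    have hZn : ‖Z‖ ≠ 0 := by
      intro h0
      rw [h0, mul_zero, zero_mul] at h
      exact hsn.ne h
    have hZ0 : star Z ≠ 0 := star_ne_zero.2 (norm_ne_zero_iff.1 hZn)
    have hcoe : ‖s‖⁻¹ * (‖Z‖ * ‖Z‖) = ‖p‖⁻¹ := by
      rw [← h]; field_simp
    rw [← mul_left_inj' hZ0, mul_assoc (‖s‖⁻¹ • s), Quaternion.self_mul_star,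
      Quaternion.normSq_eq_norm_mul_self, Quaternion.mul_coe_eq_smul, smul_smul,
      mul_comm (‖Z‖ * ‖Z‖), hcoe, mul_smul_comm, smul_mul_assoc]
    exact (smul_right_injective ℍ[ℝ] (inv_ne_zero hpn.ne')).eq_iff
  rw [hnorm]
  constructor
  · rintro ⟨h1, h2⟩
    exact (hequiv h2).1 h1
  · intro h
    have h2 : ‖Z‖ * ‖Z‖ * ‖p‖ = ‖s‖ := by
      rw [← h, norm_mul, norm_mul, Quaternion.norm_star]; ring
    exact ⟨(hequiv h2).2 h, h2⟩

/-- Completing the square in a quadratic quaternionic polynomial. -/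
theorem quadratic_translate {A : Type*} [Ring A] [StarRing A] (P Q R T Z : A) :
    (Z - T) * P * star (Z - T) + (Z - T) * Q + R * star (Z - T)
      = Z * P * star Z + (Z * (Q - P * star T) + (R - T * P) * star Z)
        + (T * P * star T - T * Q - R * star T) := by
  rw [star_sub]
  noncomm_ring

/-- `Z P Z* + Z B* + B Z* = S` splits into its vector part and its scalar part. -/
theorem reduced_quadratic_iff (P S B Z : ℍ[ℝ]) :
    Z * P * star Z + (Z * star B + B * star Z) = S ↔
      Z * P.im * star Z = S.im ∧ P.re * (‖Z‖ * ‖Z‖) + 2 * ⟪Z, B⟫_ℝ = S.re := by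
  have h1 : Z * P * star Z = ((P.re * (‖Z‖ * ‖Z‖) : ℝ) : ℍ[ℝ]) + Z * P.im * star Z := by
    conv_lhs => rw [← Quaternion.re_add_im P]
    rw [mul_add, add_mul, ← Quaternion.coe_commutes, mul_assoc (P.re : ℍ[ℝ]),
      Quaternion.self_mul_star, Quaternion.normSq_eq_norm_mul_self, ← Quaternion.coe_mul]
  have h2 : Z * star B + B * star Z = ((2 * ⟪Z, B⟫_ℝ : ℝ) : ℍ[ℝ]) := by
    rw [Quaternion.inner_def, ← Quaternion.self_add_star', star_mul, star_star]
  have h3 : (Z * P.im * star Z).re = 0 := by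
    rw [← Quaternion.star_eq_neg]
    simp [mul_assoc]
  have h4 : Z * P * star Z + (Z * star B + B * star Z)
      = ((P.re * (‖Z‖ * ‖Z‖) + 2 * ⟪Z, B⟫_ℝ : ℝ) : ℍ[ℝ]) + Z * P.im * star Z := by
    rw [h1, h2, Quaternion.coe_add]; abel
  rw [h4]
  constructor
  · rintro rfl
    generalize Z * P.im * star Z = W at *
    constructor
    · ext <;> simp [h3]
    · simp [h3]
  · rintro ⟨h5, h6⟩
    rw [h5, h6, Quaternion.re_add_im]

/-- for `P ∉ ℝ` with `S̃ ∉ ℝ`, the solution set is the translate by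
`−(R − Q*)(P − P*)⁻¹` of the intersection of the circle `C_{p,s̃}` with the hyperplane
`⟪Z, R̃⟫ = (s̃₀|p| − p₀|s̃|)/(2|p|)`. -/
theorem quadratic_quaternion_nonreal_intersection (P Q R S : ℍ[ℝ]) (hP : P.im ≠ 0)
    (Rt St : ℍ[ℝ])
    (hRt : Rt = (star Q * P - R * star P) * (P - star P)⁻¹)
    (hSt : St = S
      + (star Q * P * star R + R * star P * Q) / ((‖P - star P‖ ^ 2 : ℝ) : ℍ[ℝ])
      + R * (star P - P) * Q / ((‖P - star P‖ ^ 2 : ℝ) : ℍ[ℝ])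
      - star Q * star P * Q / ((‖P - star P‖ ^ 2 : ℝ) : ℍ[ℝ])
      - R * star P * star R / ((‖P - star P‖ ^ 2 : ℝ) : ℍ[ℝ]))
    (hs : St.im ≠ 0) :
    {X : ℍ[ℝ] | X * P * star X + X * Q + R * star X = S}
      = (fun Z => Z - (R - star Q) * (P - star P)⁻¹) ''
          {Z : ℍ[ℝ] | (Z ∈ PiPlane P.im St.im ∧ ‖Z‖ = Real.sqrt (‖St.im‖ / ‖P.im‖)) ∧
            ⟪Z, Rt⟫_ℝ = (St.re * ‖P.im‖ - P.re * ‖St.im‖) / (2 * ‖P.im‖)} := by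
  have hpn : 0 < ‖P.im‖ := norm_pos_iff.2 hP
  set n : ℝ := ‖P - star P‖ ^ 2 with hn
  set T : ℍ[ℝ] := (R - star Q) * (P - star P)⁻¹ with hT
  have hq : P - star P ≠ 0 := by
    intro h
    apply hP
    have h1 : star P = P := (sub_eq_zero.1 h).symm
    rw [Quaternion.star_eq_self] at h1
    rw [h1, Quaternion.im_coe]
  have hn0 : n ≠ 0 := pow_ne_zero 2 (norm_ne_zero_iff.2 hq)
  have hcomm : P * star P = star P * P := by
    rw [Quaternion.self_mul_star, Quaternion.star_mul_self]
  have hinv : (P - star P)⁻¹ = n⁻¹ • (star P - P) := by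
    rw [Quaternion.inv_def, Quaternion.normSq_eq_norm_mul_self, ← pow_two, star_sub, star_star]
  have hPinv : P * (P - star P)⁻¹ = (P - star P)⁻¹ * P := by
    rw [hinv, mul_smul_comm, smul_mul_assoc, mul_sub, sub_mul, hcomm]
  have hTP : R - T * P = Rt := by
    rw [hRt, hT, mul_assoc, ← hPinv, ← mul_assoc, eq_comm]
    have : R = R * (P - star P) * (P - star P)⁻¹ := (mul_inv_cancel_right₀ hq R).symm
    conv_rhs => lhs; rw [this]
    rw [← sub_mul]
    congr 1
    noncomm_ring
  have hTS : star T = n⁻¹ • ((P - star P) * (star R - Q)) := by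
    rw [hT, hinv]; simp
  have hPT : Q - P * star T = star Rt := by
    have hqi : star ((P - star P)⁻¹) = -(P - star P)⁻¹ := by
      rw [star_inv₀, star_sub, star_star, ← neg_sub, inv_neg]
    have hTs : star T = -((P - star P)⁻¹ * (star R - Q)) := by
      rw [hT, star_mul, hqi]; simp
    rw [hRt, hTs, star_mul, hqi]
    have : Q = (P - star P)⁻¹ * ((P - star P) * Q) := (inv_mul_cancel_left₀ hq Q).symm
    conv_lhs => lhs; rw [this]
    rw [mul_neg, ← mul_assoc P, hPinv, mul_assoc _ P]
    simp only [star_sub, star_mul, star_star]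
    noncomm_ring
  have hconst : T * P * star T - T * Q - R * star T = S - St := by
    have h1 : T * P * star T = n⁻¹ • ((R - star Q) * P * (star R - Q)) := by
      have : T * P * star T = (R - star Q) * P * ((P - star P)⁻¹ * star T) := by
        rw [hT, mul_assoc (R - star Q), ← hPinv]; simp only [mul_assoc]
      rw [this, hTS, mul_smul_comm, inv_mul_cancel_left₀ hq, mul_smul_comm]
    have hdiv (x : ℍ[ℝ]) : x / (n : ℍ[ℝ]) = n⁻¹ • x := by
      rw [div_eq_mul_inv, ← Quaternion.coe_inv, Quaternion.mul_coe_eq_smul]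
    have h2 : T * Q = n⁻¹ • ((R - star Q) * (star P - P) * Q) := by
      rw [hT, hinv, mul_smul_comm, smul_mul_assoc]
    rw [h1, h2, hTS, hSt]
    simp only [hdiv, mul_smul_comm]
    rw [sub_eq_iff_eq_add', ← sub_eq_zero]
    simp only [mul_sub, sub_mul, mul_assoc, smul_add, smul_sub]
    abel
  have hmain (Z : ℍ[ℝ]) :
      (Z - T) * P * star (Z - T) + (Z - T) * Q + R * star (Z - T) = S ↔
        (Z ∈ PiPlane P.im St.im ∧ ‖Z‖ = Real.sqrt (‖St.im‖ / ‖P.im‖)) ∧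
          ⟪Z, Rt⟫_ℝ = (St.re * ‖P.im‖ - P.re * ‖St.im‖) / (2 * ‖P.im‖) := by
    rw [quadratic_translate, hconst, hTP, hPT, mem_circle_iff hP (by simp) hs (by simp),
      ← add_sub_assoc, sub_eq_iff_eq_add, add_comm _ S, add_right_inj, reduced_quadratic_iff]
    refine and_congr_right fun h => ?_
    have h2 : ‖St.im‖ = ‖Z‖ * ‖Z‖ * ‖P.im‖ := by
      rw [← h, norm_mul, norm_mul, Quaternion.norm_star]; ring
    rw [h2, eq_div_iff (by positivity)]
    constructor
    · intro h3
      rw [← h3]; ring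
    · intro h3
      apply mul_right_cancel₀ hpn.ne'
      linarith
  ext X
  simp only [Set.mem_ofPred_eq, Set.mem_image]
  constructor
  · intro h
    refine ⟨X + T, (hmain _).1 ?_, add_sub_cancel_right X T⟩
    rwa [add_sub_cancel_right]
  · rintro ⟨Z, hZ, rfl⟩
    exact (hmain Z).2 hZ
end

section
/- Let P, Q, R, S ∈ ℍ with P ∉ ℝ, write p = vect(P) ≠ 0, and define R̃ = (Q*P − RP*)(P − P*)^{-1} and S̃ = S + (Q*PR* + RP*Q)/|P − P*|² + R(P* − P)Q/|P − P*|² − Q*P*Q/|P − P*|² − RP*R*/|P − P*|², with s̃ = vect(S̃). If S̃ ∉ ℝ and R̃ is not orthogonal to the 2-plane Π_{p,s̃} with respect to the Euclidean inner product on ℍ ≅ ℝ⁴, then the equation X P X* + X Q + R X* = S has at most two solutions X ∈ ℍ. -/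
open Quaternion
open scoped InnerProductSpace Classical

/-- Completing the square: with `C = (Q* - R) (P - P*)⁻¹` the substitution `X = Y + C` turns
`X P X* + X Q + R X* = S` into an equation whose linear part is self-adjoint. -/
theorem exists_shift_selfAdjoint_form (P Q R S : ℍ[ℝ]) (hP : P.im ≠ 0) (Rt St : ℍ[ℝ])
    (hRt : Rt = (star Q * P - R * star P) * (P - star P)⁻¹)
    (hSt : St = S
      + (star Q * P * star R + R * star P * Q) / ((‖P - star P‖ ^ 2 : ℝ) : ℍ[ℝ])
      + R * (star P - P) * Q / ((‖P - star P‖ ^ 2 : ℝ) : ℍ[ℝ])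
      - star Q * star P * Q / ((‖P - star P‖ ^ 2 : ℝ) : ℍ[ℝ])
      - R * star P * star R / ((‖P - star P‖ ^ 2 : ℝ) : ℍ[ℝ])) :
    ∃ C : ℍ[ℝ], ∀ X : ℍ[ℝ], X * P * star X + X * Q + R * star X = S →
      (X - C) * P * star (X - C) + (X - C) * star Rt + Rt * star (X - C) = St := by
  have hd0 : P - star P ≠ 0 := by
    intro h
    apply hP
    have h2 : P.im + P.im = P - star P := by ext <;> simp
    rw [h, ← two_smul ℝ, smul_eq_zero] at h2
    exact h2.resolve_left two_ne_zero
  obtain ⟨d, hd⟩ : ∃ d, d = P - star P := ⟨_, rfl⟩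
  obtain ⟨e, he⟩ : ∃ e, e = d⁻¹ := ⟨_, rfl⟩
  rw [← hd] at hd0 hRt hSt
  rw [← he] at hRt
  have hde : d * e = 1 := by rw [he, mul_inv_cancel₀ hd0]
  have hed : e * d = 1 := by rw [he, inv_mul_cancel₀ hd0]
  have hsd : star d = -d := by rw [hd]; simp
  have hse : star e = -e := by rw [he, star_inv₀, hsd, inv_neg]
  have hPs : star P = P - d := by rw [hd]; abel
  have hdP : d * P = P * d := by
    rw [hd]; ext <;> simp <;> ring
  have heP : e * P = P * e := by
    calc e * P = e * (P * d) * e := by rw [mul_assoc, mul_assoc, hde, mul_one]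
      _ = e * (d * P) * e := by rw [hdP]
      _ = P * e := by rw [← mul_assoc e, hed, one_mul]
  have hn : ((‖d‖ ^ 2 : ℝ) : ℍ[ℝ])⁻¹ = -(e * e) := by
    rw [pow_two, ← Quaternion.normSq_eq_norm_mul_self, ← Quaternion.self_mul_star, hsd, mul_neg,
      inv_neg, mul_inv_rev, he]
  have hcent : ∀ Z : ℍ[ℝ], Z * (e * e) = e * e * Z := by
    intro Z
    have h : e * e = ((-(‖d‖ ^ 2)⁻¹ : ℝ) : ℍ[ℝ]) := by
      rw [Quaternion.coe_neg, Quaternion.coe_inv, hn, neg_neg]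
    rw [h]
    exact (Quaternion.coe_commutes _ _).symm
  have hePe : e * P * e = P * (e * e) := by rw [heP, mul_assoc]
  refine ⟨(star Q - R) * e, fun X hX => ?_⟩
  have hE : e * e * d = e := by rw [mul_assoc, hed, mul_one]
  have hmove : ∀ A B : ℍ[ℝ], A * e * B = A * d * B * (e * e) := by
    intro A B
    calc A * e * B = A * (e * e * d) * B := by rw [hE]
      _ = A * (e * e * (d * B)) := by simp only [mul_assoc]
      _ = A * d * B * (e * e) := by rw [← hcent]; simp only [mul_assoc]
  have hsC : star ((star Q - R) * e) = e * (star R - Q) := by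
    rw [star_mul, hse, star_sub, star_star]
    noncomm_ring
  have hR₁ : Rt = R + (star Q - R) * e * P := by
    calc Rt = (star Q - R) * (P * e) + R * (d * e) := by rw [hRt, hPs]; noncomm_ring
      _ = R + (star Q - R) * e * P := by rw [hde, ← heP, mul_one, add_comm, ← mul_assoc]
  have hR₂ : Rt = star Q + (star Q - R) * e * star P := by
    calc Rt = R + (star Q - R) * e * P := hR₁
      _ = R + (star Q - R) * (e * d) + (star Q - R) * e * star P := by rw [hPs]; noncomm_ring
      _ = star Q + (star Q - R) * e * star P := by rw [hed]; noncomm_ring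
  have hsR : star Rt = Q + P * (e * (star R - Q)) := by
    rw [hR₂, star_add, star_mul, hsC, star_star, star_star]
  have hconst : St = S - (star Q - R) * e * P * (e * (star R - Q)) - (star Q - R) * e * Q
      - R * (e * (star R - Q)) := by
    have h₁ : (star Q - R) * e * P * (e * (star R - Q))
        = (star Q - R) * P * (star R - Q) * (e * e) := by
      calc _ = (star Q - R) * (e * P * e) * (star R - Q) := by noncomm_ring
        _ = (star Q - R) * P * ((e * e) * (star R - Q)) := by rw [hePe]; noncomm_ring
        _ = _ := by rw [← hcent, ← mul_assoc]
    rw [h₁, hmove, ← mul_assoc R, hmove, hSt]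
    simp only [div_eq_mul_inv, hn, hPs]
    generalize e * e = E
    noncomm_ring
  rw [hconst, hsR, hR₁, star_sub, hsC, ← hX]
  noncomm_ring

theorem coe_add_smul_of_commute {q w : ℍ[ℝ]} (hre : q.re = 0) (hq : q * q = -1)
    (h : w * q = q * w) : ∃ a b : ℝ, w = (a : ℍ[ℝ]) + b • q := by
  have h0 := congrArg QuaternionAlgebra.re hq
  have h1 := congrArg QuaternionAlgebra.imI h
  have h2 := congrArg QuaternionAlgebra.imJ h
  have h3 := congrArg QuaternionAlgebra.imK h
  simp [hre] at h0 h1 h2 h3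
  refine ⟨w.re, w.imI * q.imI + w.imJ * q.imJ + w.imK * q.imK, ?_⟩
  ext
  · simp [hre]
  · simp
    linear_combination w.imI * h0 - q.imK / 2 * h2 + q.imJ / 2 * h3
  · simp
    linear_combination w.imJ * h0 + q.imK / 2 * h1 - q.imI / 2 * h3
  · simp
    linear_combination w.imK * h0 - q.imJ / 2 * h1 + q.imI / 2 * h2

/-- The quaternions `Z` with `Z q = r Z`, for an imaginary unit `q`, form a right complex line. -/
theorem exists_smul_add_smul_of_intertwines {q r Y Z : ℍ[ℝ]} (hre : q.re = 0) (hq : q * q = -1)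
    (hY0 : Y ≠ 0) (hY : Y * q = r * Y) (hZ : Z * q = r * Z) :
    ∃ a b : ℝ, Z = a • Y + b • (Y * q) := by
  have hcomm : (Y⁻¹ * Z) * q = q * (Y⁻¹ * Z) := by
    apply mul_left_cancel₀ hY0
    rw [← mul_assoc Y q, hY, ← mul_assoc, mul_inv_cancel_left₀ hY0, mul_assoc r,
      mul_inv_cancel_left₀ hY0, hZ]
  obtain ⟨a, b, hab⟩ := coe_add_smul_of_commute hre hq hcomm
  refine ⟨a, b, ?_⟩
  rw [← mul_inv_cancel_left₀ hY0 Z, hab, mul_add, Quaternion.mul_coe_eq_smul, mul_smul_comm]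

theorem normSq_smul_add_smul_mul {q : ℍ[ℝ]} (hre : q.re = 0) (hq : q * q = -1) (Y : ℍ[ℝ])
    (a b : ℝ) : normSq (a • Y + b • (Y * q)) = (a ^ 2 + b ^ 2) * normSq Y := by
  have h0 := congrArg QuaternionAlgebra.re hq
  simp [hre] at h0
  have : a • Y + b • (Y * q) = Y * ((a : ℍ[ℝ]) + b • q) := by
    rw [mul_add, Quaternion.mul_coe_eq_smul, mul_smul_comm]
  rw [this, map_mul, mul_comm, Quaternion.normSq_def' ((a : ℍ[ℝ]) + b • q)]
  simp [hre]
  left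
  linear_combination (-b ^ 2) * h0

/-- A line meets the unit circle in `(1, 0)` and at most one further point. -/
theorem eq_or_eq_of_line_unitCircle {α β a b : ℝ} (h0 : α ≠ 0 ∨ β ≠ 0) (hab : a ^ 2 + b ^ 2 = 1)
    (hl : a * α + b * β = α) :
    (a = 1 ∧ b = 0) ∨
      (a = (α ^ 2 - β ^ 2) / (α ^ 2 + β ^ 2) ∧ b = 2 * α * β / (α ^ 2 + β ^ 2)) := by
  have hpos : α ^ 2 + β ^ 2 ≠ 0 := by
    rcases h0 with h | h <;> positivity
  by_cases ha : a = 1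
  · left
    refine ⟨ha, ?_⟩
    subst ha
    nlinarith
  · right
    have ha' : 1 - a ≠ 0 := sub_ne_zero.mpr (Ne.symm ha)
    have hβ : β ≠ 0 := by
      rintro rfl
      have : (1 - a) * α = 0 := by linarith
      rcases mul_eq_zero.mp this with h | h
      · exact ha' h
      · simp [h] at h0
    have h1 : a * (α ^ 2 + β ^ 2) = α ^ 2 - β ^ 2 := by
      apply mul_left_cancel₀ ha'
      linear_combination (b * β + α * (1 - a)) * hl - β ^ 2 * hab
    refine ⟨(eq_div_iff hpos).mpr h1, (eq_div_iff hpos).mpr ?_⟩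
    apply mul_left_cancel₀ hβ
    linear_combination (α ^ 2 + β ^ 2) * hl - α * h1

theorem normalize_re {p : ℍ[ℝ]} (hp : p.re = 0) : (‖p‖⁻¹ • p).re = 0 := by simp [hp]

theorem normalize_mul_self {p : ℍ[ℝ]} (hp : p.re = 0) (hp0 : p ≠ 0) :
    (‖p‖⁻¹ • p) * (‖p‖⁻¹ • p) = -1 := by
  have hn : ‖p‖ ≠ 0 := norm_ne_zero_iff.mpr hp0
  have hs : star p = -p := Quaternion.star_eq_neg.mpr hp
  have h : p * p = -((‖p‖ * ‖p‖ : ℝ) : ℍ[ℝ]) := by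
    rw [← Quaternion.normSq_eq_norm_mul_self, ← Quaternion.self_mul_star, hs, mul_neg, neg_neg]
  rw [smul_mul_smul_comm, h, smul_neg, ← Quaternion.coe_smul, smul_eq_mul,
    ← mul_inv, inv_mul_cancel₀ (mul_ne_zero hn hn), Quaternion.coe_one]

theorem mul_normalize_eq_of_mem_PiPlane {p s Z : ℍ[ℝ]} (hp : p.re = 0) (hp0 : p ≠ 0)
    (hs : s.re = 0) (hs0 : s ≠ 0) (hZ : Z ∈ PiPlane p s) :
    Z * (‖p‖⁻¹ • p) = (‖s‖⁻¹ • s) * Z := by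
  have hq := normalize_mul_self hp hp0
  have hr := normalize_mul_self hs hs0
  have hqre := normalize_re hp
  unfold PiPlane at hZ
  generalize ‖p‖⁻¹ • p = q at *
  generalize ‖s‖⁻¹ • s = r at *
  split_ifs at hZ with h
  · obtain ⟨hZre, hZq⟩ := hZ
    rw [Quaternion.inner_def] at hZq
    simp [hZre, hqre] at hZq
    rw [h]
    ext
    · simp [hZre, hqre]
      linear_combination (-2) * hZq
    all_goals
      simp [hZre, hqre]
      try ring
  · obtain ⟨z, ⟨a, b, rfl⟩, rfl⟩ := hZ
    have hz : ((a : ℍ[ℝ]) + b * q) * q = q * ((a : ℍ[ℝ]) + b * q) := by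
      rw [add_mul, mul_add, ← mul_assoc q, Quaternion.coe_commutes a, Quaternion.coe_commutes b]
    have hu : (q + r) * q = r * (q + r) := by
      rw [add_mul, mul_add, hq, hr, add_comm]
    simp only [smul_mul_assoc, mul_smul_comm]
    rw [mul_assoc, hz, ← mul_assoc, hu, mul_assoc]

theorem mul_normalize_eq_of_conj_eq {p s Y : ℍ[ℝ]} (hp0 : p ≠ 0) (hs0 : s ≠ 0)
    (h : Y * p * star Y = s) :
    Y ≠ 0 ∧ normSq Y = ‖s‖ / ‖p‖ ∧ Y * (‖p‖⁻¹ • p) = (‖s‖⁻¹ • s) * Y := by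
  have hY0 : Y ≠ 0 := by
    rintro rfl
    simp at h
    exact hs0 h.symm
  have hn : ‖p‖ ≠ 0 := norm_ne_zero_iff.mpr hp0
  have hN : normSq Y ≠ 0 := by simpa using hY0
  have hs : ‖s‖ = normSq Y * ‖p‖ := by
    rw [← h, norm_mul, norm_mul, norm_star, Quaternion.normSq_eq_norm_mul_self]
    ring
  refine ⟨hY0, by rw [hs]; field_simp, ?_⟩
  have h1 : s * Y = normSq Y • (Y * p) := by
    rw [← h, mul_assoc, Quaternion.star_mul_self, Quaternion.mul_coe_eq_smul]
  rw [smul_mul_assoc, h1, smul_smul, hs, mul_smul_comm]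
  congr 1
  field_simp

/-- for `P ∉ ℝ` with `S̃ ∉ ℝ` and `R̃` not orthogonal to `Π_{p,s̃}`,
the equation `X P X* + X Q + R X* = S` has at most two solutions. -/
theorem quadratic_quaternion_nonreal_at_most_two (P Q R S : ℍ[ℝ]) (hP : P.im ≠ 0)
    (Rt St : ℍ[ℝ])
    (hRt : Rt = (star Q * P - R * star P) * (P - star P)⁻¹)
    (hSt : St = S
      + (star Q * P * star R + R * star P * Q) / ((‖P - star P‖ ^ 2 : ℝ) : ℍ[ℝ])
      + R * (star P - P) * Q / ((‖P - star P‖ ^ 2 : ℝ) : ℍ[ℝ])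
      - star Q * star P * Q / ((‖P - star P‖ ^ 2 : ℝ) : ℍ[ℝ])
      - R * star P * star R / ((‖P - star P‖ ^ 2 : ℝ) : ℍ[ℝ]))
    (hs : St.im ≠ 0)
    (hnorth : ¬ ∀ Z ∈ PiPlane P.im St.im, ⟪Z, Rt⟫_ℝ = 0) :
    ∃ a b : ℍ[ℝ], {X : ℍ[ℝ] | X * P * star X + X * Q + R * star X = S} ⊆ {a, b} := by
  obtain ⟨C, hC⟩ := exists_shift_selfAdjoint_form P Q R S hP Rt St hRt hSt
  have hpre : P.im.re = 0 := Quaternion.re_im P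
  have hsre : St.im.re = 0 := Quaternion.re_im St
  have key : ∀ X : ℍ[ℝ], X * P * star X + X * Q + R * star X = S →
      (X - C) * P.im * star (X - C) = St.im ∧
        P.re * normSq (X - C) + 2 * ⟪X - C, Rt⟫_ℝ = St.re := by
    intro X hX
    have h := hC X hX
    generalize X - C = Y at h
    rw [← h, Quaternion.inner_def, Quaternion.normSq_def']
    constructor
    · ext <;> simp <;> ring
    · simp
      ring
  have hqre := normalize_re hpre
  have hqq := normalize_mul_self hpre hP
  push Not at hnorth
  obtain ⟨Z, hZ, hZR⟩ := hnorth
  have hZq := mul_normalize_eq_of_mem_PiPlane hpre hP hsre hs hZ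
  have conj : ∀ {Y : ℍ[ℝ]}, Y * P.im * star Y = St.im → _ :=
    fun h => mul_normalize_eq_of_conj_eq hP hs h
  generalize ‖P.im‖⁻¹ • P.im = q at *
  rcases Set.eq_empty_or_nonempty {X : ℍ[ℝ] | X * P * star X + X * Q + R * star X = S} with
    he | ⟨X₁, hX₁⟩
  · exact ⟨0, 0, by simp [he]⟩
  obtain ⟨hc₁, hr₁⟩ := key X₁ hX₁
  obtain ⟨hY0, hN₁, hY₁⟩ := conj hc₁
  obtain ⟨Y, hY⟩ : ∃ Y, Y = X₁ - C := ⟨_, rfl⟩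
  rw [← hY] at hY0 hN₁ hY₁ hr₁
  have hαβ : ⟪Y, Rt⟫_ℝ ≠ 0 ∨ ⟪Y * q, Rt⟫_ℝ ≠ 0 := by
    by_contra! h
    obtain ⟨a, b, rfl⟩ := exists_smul_add_smul_of_intertwines hqre hqq hY0 hY₁ hZq
    apply hZR
    rw [inner_add_left, real_inner_smul_left, real_inner_smul_left, h.1, h.2]
    simp
  obtain ⟨α, hα⟩ : ∃ α, α = ⟪Y, Rt⟫_ℝ := ⟨_, rfl⟩
  obtain ⟨β, hβ⟩ : ∃ β, β = ⟪Y * q, Rt⟫_ℝ := ⟨_, rfl⟩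
  rw [← hα, ← hβ] at hαβ
  refine ⟨X₁, C + (((α ^ 2 - β ^ 2) / (α ^ 2 + β ^ 2)) • Y +
    (2 * α * β / (α ^ 2 + β ^ 2)) • (Y * q)), fun X hX => ?_⟩
  obtain ⟨hc, hr⟩ := key X hX
  obtain ⟨-, hN, hXq⟩ := conj hc
  obtain ⟨a, b, hab⟩ := exists_smul_add_smul_of_intertwines hqre hqq hY0 hY₁ hXq
  have hcirc : a ^ 2 + b ^ 2 = 1 := by
    have hN0 : normSq Y ≠ 0 := by simpa using hY0
    apply mul_right_cancel₀ hN0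
    rw [← normSq_smul_add_smul_mul hqre hqq, ← hab, hN, hN₁, one_mul]
  have hline : a * α + b * β = α := by
    have h : ⟪X - C, Rt⟫_ℝ = ⟪Y, Rt⟫_ℝ := by
      rw [hN] at hr
      rw [hN₁] at hr₁
      linarith
    rw [hab, inner_add_left, real_inner_smul_left, real_inner_smul_left, ← hα, ← hβ] at h
    exact h
  rw [Set.mem_insert_iff, Set.mem_singleton_iff]
  rcases eq_or_eq_of_line_unitCircle hαβ hcirc hline with ⟨ha, hb⟩ | ⟨ha, hb⟩
  · left
    rw [ha, hb, one_smul, zero_smul, add_zero, hY] at hab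
    exact sub_left_injective hab
  · right
    rw [← ha, ← hb, ← hab]
    abel
end
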